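/- arXiv:2202.12494 — 5 statements merged into one kernel-verified Lean document; each statement's English description precedes it below -/
import Mathlib

section
/- For all natural numbers n ≥ 1 and q with 1 ≤ q ≤ n, the identity ∑_{p=0}^{n-q} (-1)^{p+q} · |s(n, n-p)| · binomial(n-p, q) = (-1)^{n-1} · ( |s(n-1, q)| - |s(n-1, q-1)| ) holds, where |s(·,·)| are unsigned Stirling numbers of the first kind. -/
open Polynomial Finset

theorem hasseDeriv_eval_eq_sum_range {R : Type*} [CommSemiring R] (f : R[X]) (q N : ℕ)
    (hN : f.natDegree < N) (r : R) :
    (hasseDeriv q f).eval r =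
      ∑ k ∈ Finset.range N, (k.choose q : R) * f.coeff k * r ^ (k - q) := by
  rw [hasseDeriv_apply, sum_over_range' f (by simp) N hN, eval_finsetSum]
  simp [eval_monomial]

theorem taylor_neg_one_ascPochhammer_succ {R : Type*} [CommRing R] (m : ℕ) :
    taylor (-1) (ascPochhammer R (m + 1)) = (X - 1) * ascPochhammer R m := by
  rw [taylor_apply, ascPochhammer_succ_left, mul_comp, comp_assoc]
  simp [sub_eq_add_neg]

/-- For `1 ≤ q ≤ n`, one has
`∑_{p=0}^{n-q} (-1)^{p+q} |s(n, n-p)| C(n-p, q) = (-1)^{n-1} (|s(n-1, q)| - |s(n-1, q-1)|)`,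
where the unsigned Stirling number of the first kind `|s(n,k)|` is the coefficient of `X^k`
in the ascending factorial polynomial `ascPochhammer ℤ n`. -/
theorem euler_char_stirling (n q : ℕ) (hn : 1 ≤ n) (hq1 : 1 ≤ q) (hqn : q ≤ n) :
    ∑ p ∈ Finset.range (n - q + 1),
        (-1 : ℤ) ^ (p + q) * (ascPochhammer ℤ n).coeff (n - p) * ((n - p).choose q : ℤ) =
      (-1 : ℤ) ^ (n - 1) *
        ((ascPochhammer ℤ (n - 1)).coeff q - (ascPochhammer ℤ (n - 1)).coeff (q - 1)) := by
  obtain ⟨m, rfl⟩ : ∃ m, n = m + 1 := ⟨n - 1, by lia⟩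
  obtain ⟨r, rfl⟩ : ∃ r, q = r + 1 := ⟨q - 1, by lia⟩
  have hcoeff := congrArg (coeff · (r + 1)) (taylor_neg_one_ascPochhammer_succ (R := ℤ) m)
  simp only [taylor_coeff, sub_mul, one_mul, coeff_sub, coeff_X_mul] at hcoeff
  rw [hasseDeriv_eval_eq_sum_range _ _ (m + 2) (by simp [ascPochhammer_natDegree]),
    ← Finset.sum_range_reflect] at hcoeff
  have hsum : ∑ p ∈ Finset.range (m + 1 - (r + 1) + 1), (-1 : ℤ) ^ (p + (r + 1)) *
      (ascPochhammer ℤ (m + 1)).coeff (m + 1 - p) * ((m + 1 - p).choose (r + 1) : ℤ) =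
      ∑ p ∈ Finset.range (m + 2), (-1 : ℤ) ^ (m + 1) *
        (((m + 2 - 1 - p).choose (r + 1) : ℤ) * (ascPochhammer ℤ (m + 1)).coeff (m + 2 - 1 - p) *
          (-1) ^ (m + 2 - 1 - p - (r + 1))) := by
    refine Finset.sum_subset_zero_on_sdiff (Finset.range_subset_range.2 (by lia)) ?_ ?_
    · intro p hp
      simp only [Finset.mem_sdiff, Finset.mem_range] at hp
      rw [Nat.choose_eq_zero_of_lt (by lia)]
      simp
    · intro p hp
      rw [Finset.mem_range] at hp
      have hsign : (-1 : ℤ) ^ (p + (r + 1)) =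
          (-1) ^ (m + 1) * (-1) ^ (m + 1 - p - (r + 1)) := by
        obtain ⟨d, hd⟩ : ∃ d, m + 1 = p + (r + 1) + d := ⟨m + 1 - p - (r + 1), by lia⟩
        rw [show m + 1 - p - (r + 1) = d by lia, hd, pow_add _ _ d, mul_assoc, ← mul_pow]
        simp
      rw [hsign, show m + 2 - 1 = m + 1 from rfl]
      ring
  rw [hsum, ← Finset.mul_sum, hcoeff, Nat.add_sub_cancel, Nat.add_sub_cancel]
  ring
end

section
/- The quantity 2·( |s(n-1,3)| - |s(n-1,2)| ) / ( (n-2)! · (log n)² ) tends to 1 as n → ∞, where |s(·,·)| are unsigned Stirling numbers of the first kind and log is the natural logarithm. In particular 2(|s(n-1,3)| - |s(n-1,2)|), which is the absolute value of the Euler-characteristic multiplicity χ[n,(2,1)] of the Schur functor S_{(2,1)}, grows super-exponentially in n. -/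
open Filter

lemma ascPochhammer_coeff_succ_succ (n k : ℕ) :
    (ascPochhammer ℝ (n + 1)).coeff (k + 1) =
      (ascPochhammer ℝ n).coeff k + n * (ascPochhammer ℝ n).coeff (k + 1) := by
  rw [ascPochhammer_succ_right, mul_add, Polynomial.coeff_add, Polynomial.coeff_mul_X,
    Polynomial.coeff_mul_natCast, mul_comm (n : ℝ)]

lemma ascPochhammer_succ_coeff_zero (n : ℕ) : (ascPochhammer ℝ (n + 1)).coeff 0 = 0 := by
  rw [ascPochhammer_succ_left, Polynomial.coeff_X_mul_zero]

lemma ascPochhammer_succ_coeff_one (n : ℕ) :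
    (ascPochhammer ℝ (n + 1)).coeff 1 = n.factorial := by
  induction n with
  | zero => simp
  | succ n ih =>
    rw [ascPochhammer_coeff_succ_succ (n + 1) 0, ih, ascPochhammer_succ_coeff_zero,
      Nat.factorial_succ]
    push_cast
    ring

lemma ascPochhammer_succ_coeff_two (n : ℕ) :
    (ascPochhammer ℝ (n + 1)).coeff 2 = n.factorial * (harmonic n : ℝ) := by
  induction n with
  | zero => simp [Polynomial.coeff_X]
  | succ n ih =>
    rw [ascPochhammer_coeff_succ_succ (n + 1) 1, ih, ascPochhammer_succ_coeff_one,
      Nat.factorial_succ, harmonic_succ]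
    have : (n : ℝ) + 1 ≠ 0 := by positivity
    push_cast
    field_simp
    ring

lemma two_mul_ascPochhammer_succ_coeff_three (n : ℕ) :
    2 * (ascPochhammer ℝ (n + 1)).coeff 3 =
      n.factorial * ((harmonic n : ℝ) ^ 2 - ∑ i ∈ Finset.range n, 1 / ((i + 1 : ℕ) : ℝ) ^ 2) := by
  induction n with
  | zero => simp [Polynomial.coeff_X]
  | succ n ih =>
    rw [ascPochhammer_coeff_succ_succ (n + 1) 2, mul_add, mul_left_comm, ih,
      ascPochhammer_succ_coeff_two, Nat.factorial_succ, harmonic_succ, Finset.sum_range_succ]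
    have : (n : ℝ) + 1 ≠ 0 := by positivity
    push_cast
    field_simp
    ring

lemma abs_harmonic_sub_log_add_two_le (n : ℕ) :
    |(harmonic n : ℝ) - Real.log ((n + 2 : ℕ) : ℝ)| ≤ 1 := by
  have lower := log_add_one_le_harmonic n
  have upper := harmonic_le_one_add_log n
  have mono : Real.log n ≤ Real.log ((n + 2 : ℕ) : ℝ) := by
    rcases Nat.eq_zero_or_pos n with rfl | hn
    · simpa using Real.log_nonneg (by norm_num : (1 : ℝ) ≤ 2)
    · exact Real.log_le_log (by exact_mod_cast hn) (by push_cast; linarith)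
  have shift : Real.log ((n + 2 : ℕ) : ℝ) ≤ Real.log 2 + Real.log ((n + 1 : ℕ) : ℝ) := by
    rw [← Real.log_mul (by norm_num) (by positivity)]
    exact Real.log_le_log (by positivity) (by push_cast; linarith [n.cast_nonneg (α := ℝ)])
  have := Real.log_two_lt_d9
  rw [abs_le]
  constructor <;> linarith

lemma tendsto_log_add_two_atTop :
    Tendsto (fun n : ℕ => Real.log ((n + 2 : ℕ) : ℝ)) atTop atTop :=
  Real.tendsto_log_atTop.comp
    (tendsto_natCast_atTop_atTop.comp (tendsto_add_atTop_nat 2))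

lemma log_add_two_pos (n : ℕ) : 0 < Real.log ((n + 2 : ℕ) : ℝ) :=
  Real.log_pos (by push_cast; linarith [n.cast_nonneg (α := ℝ)])

lemma tendsto_harmonic_div_log_add_two :
    Tendsto (fun n : ℕ => (harmonic n : ℝ) / Real.log ((n + 2 : ℕ) : ℝ)) atTop (nhds 1) := by
  rw [tendsto_iff_norm_sub_tendsto_zero]
  refine squeeze_zero (fun _ => norm_nonneg _) (fun n => ?_) tendsto_log_add_two_atTop.inv_tendsto_atTop
  have hL := log_add_two_pos n
  rw [div_sub_one hL.ne', norm_div, Real.norm_eq_abs, Real.norm_of_nonneg hL.le, Pi.inv_apply,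
    inv_eq_one_div]
  gcongr
  exact abs_harmonic_sub_log_add_two_le n

lemma tendsto_stirling_diff_div_factorial_mul_log_sq :
    Tendsto
      (fun n : ℕ =>
        (2 * ((ascPochhammer ℝ (n + 1)).coeff 3 - (ascPochhammer ℝ (n + 1)).coeff 2)) /
          ((n.factorial : ℝ) * (Real.log ((n + 2 : ℕ) : ℝ)) ^ 2))
      atTop (nhds 1) := by
  have hH := tendsto_harmonic_div_log_add_two
  have hL := tendsto_log_add_two_atTop
  have hsum : Summable fun i : ℕ => 1 / ((i + 1 : ℕ) : ℝ) ^ 2 :=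
    (summable_nat_add_iff 1).2 (Real.summable_one_div_nat_pow.2 one_lt_two)
  have hS := hsum.hasSum.tendsto_sum_nat.div_atTop
    ((tendsto_pow_atTop two_ne_zero).comp hL)
  have hmain := ((hH.pow 2).sub hS).sub ((hH.const_mul 2).div_atTop hL)
  rw [one_pow, sub_zero, sub_zero] at hmain
  refine hmain.congr fun n => ?_
  have hpos := (log_add_two_pos n).ne'
  have hfac : (n.factorial : ℝ) ≠ 0 := by positivity
  rw [mul_sub, two_mul_ascPochhammer_succ_coeff_three, ascPochhammer_succ_coeff_two]
  simp only [Function.comp_apply]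
  field_simp

lemma tendsto_factorial_div_pow_atTop {b : ℝ} (hb : 0 < b) :
    Tendsto (fun n : ℕ => (n.factorial : ℝ) / b ^ n) atTop atTop := by
  have h : Tendsto (fun n : ℕ => b ^ n / (n.factorial : ℝ)) atTop (nhdsWithin 0 (Set.Ioi 0)) :=
    tendsto_nhdsWithin_iff.2 ⟨FloorSemiring.tendsto_pow_div_factorial_atTop b,
      Eventually.of_forall fun n => Set.mem_Ioi.2 (by positivity)⟩
  simpa only [Pi.inv_def, inv_div] using h.inv_tendsto_nhdsGT_zero

/-- The quantity `2(|s(n-1,3)| - |s(n-1,2)|)`, i.e. the absolute value of the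
Euler-characteristic multiplicity `χ[n,(2,1)]` of the Schur functor `S_{(2,1)}`, is
asymptotic to `(n-2)! (log n)²` as `n → ∞`; in particular it grows super-exponentially.
Here `|s(m,k)|` is the coefficient of `X^k` in `ascPochhammer ℝ m`. -/
theorem chi_n_21_asymptotics :
    Tendsto
      (fun n : ℕ =>
        (2 * ((ascPochhammer ℝ (n - 1)).coeff 3 - (ascPochhammer ℝ (n - 1)).coeff 2)) /
          ((Nat.factorial (n - 2) : ℝ) * (Real.log n) ^ 2))
      atTop (nhds 1) ∧
    ∀ b : ℝ, 1 < b →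
      Tendsto
        (fun n : ℕ =>
          (2 * ((ascPochhammer ℝ (n - 1)).coeff 3 - (ascPochhammer ℝ (n - 1)).coeff 2)) / b ^ n)
        atTop atTop := by
  have hratio := tendsto_stirling_diff_div_factorial_mul_log_sq
  refine ⟨(tendsto_add_atTop_iff_nat 2).1 hratio, fun b hb => ?_⟩
  have hb0 : 0 < b := one_pos.trans hb
  refine (tendsto_add_atTop_iff_nat 2).1 ?_
  have hlog := (tendsto_pow_atTop two_ne_zero).comp tendsto_log_add_two_atTop
  have hprod := ((hlog.atTop_mul_atTop₀ (tendsto_factorial_div_pow_atTop hb0)).atTop_mul_pos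
    one_pos hratio).atTop_div_const (pow_pos hb0 2)
  refine hprod.congr fun n => ?_
  have hpos := (log_add_two_pos n).ne'
  have hfac : (n.factorial : ℝ) ≠ 0 := by positivity
  simp only [Function.comp_apply, Nat.add_succ_sub_one, pow_add]
  field_simp
end

section
/- Let X and Y be locally compact Hausdorff topological spaces, f : X → Y a proper continuous map, and n : ℕ. Then the map between one-point compactifications OnePoint F(X,n) → OnePoint F(Y,n), which sends the point at infinity to the point at infinity, sends x : Fin n → X with f ∘ x injective to f ∘ x, and sends x with f ∘ x not injective to the point at infinity, is continuous. -/
open OnePoint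
open scoped Classical

/-- The ordered configurations form an open subset of a finite power of a Hausdorff space. -/
theorem isOpen_setOf_injective {ι Z : Type*} [Finite ι] [TopologicalSpace Z] [T2Space Z] :
    IsOpen {z : ι → Z | Function.Injective z} := by
  have h : {z : ι → Z | Function.Injective z} = ⋂ i, ⋂ j, {z | z i = z j → i = j} := by
    ext z
    simp [Function.Injective]
  rw [h]
  refine isOpen_iInter_of_finite fun i => isOpen_iInter_of_finite fun j => ?_
  by_cases hij : i = j
  · simp [hij]
  · simpa [hij] using isOpen_ne_fun (continuous_apply (A := fun _ : ι => Z) i)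
      (continuous_apply j)

/-- A proper map pulls back compact sets of configurations to compact sets of configurations. -/
theorem IsProperMap.isCompact_preimage_config {ι X Y : Type*} [TopologicalSpace X]
    [TopologicalSpace Y] {f : X → Y} (hf : IsProperMap f)
    {K : Set {y : ι → Y // Function.Injective y}} (hK : IsCompact K) :
    IsCompact {x : {x : ι → X // Function.Injective x} | f ∘ x.1 ∈ Subtype.val '' K} := by
  have hpi : IsProperMap (fun x : ι → X => f ∘ x) := IsProperMap.pi_map fun _ => hf
  rw [Subtype.isCompact_iff]
  convert hpi.isCompact_preimage (hK.image continuous_subtype_val) using 1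
  ext x
  constructor
  · rintro ⟨x, hx, rfl⟩
    exact hx
  · rintro ⟨y, hy, hyx⟩
    have hx : Function.Injective (f ∘ x) := (show y.1 = f ∘ x from hyx) ▸ y.2
    exact ⟨⟨x, hx.of_comp⟩, ⟨y, hy, hyx⟩, rfl⟩

/-- For a proper continuous map `f : X → Y` between locally compact Hausdorff spaces, the map
between one-point compactifications `OnePoint F(X,n) → OnePoint F(Y,n)` sending `∞ ↦ ∞`,
sending a configuration `x` with `f ∘ x` injective to `f ∘ x`, and sending `x` with `f ∘ x`
not injective to `∞`, is continuous. -/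
theorem continuous_onePoint_config_map {X Y : Type*} [TopologicalSpace X] [TopologicalSpace Y]
    [LocallyCompactSpace X] [T2Space X] [LocallyCompactSpace Y] [T2Space Y]
    (f : X → Y) (hf : IsProperMap f) (n : ℕ) :
    Continuous (fun z : OnePoint {x : Fin n → X // Function.Injective x} =>
      Option.elim z (OnePoint.infty : OnePoint {y : Fin n → Y // Function.Injective y})
        (fun x => if h : Function.Injective (f ∘ x.1)
          then ((⟨f ∘ x.1, h⟩ : {y : Fin n → Y // Function.Injective y}) :
            OnePoint {y : Fin n → Y // Function.Injective y})
          else OnePoint.infty)) := by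
  rw [continuous_def]
  intro S hS
  by_cases hmem : ∞ ∈ S
  · rw [OnePoint.isOpen_iff_of_mem hmem] at hS
    have hK := hf.isCompact_preimage_config hS.2
    rw [OnePoint.isOpen_iff_of_mem (by exact hmem)]
    have heq : ((↑) ⁻¹' ((fun z : OnePoint {x : Fin n → X // Function.Injective x} =>
        Option.elim z (OnePoint.infty : OnePoint {y : Fin n → Y // Function.Injective y})
          (fun x => if h : Function.Injective (f ∘ x.1)
            then ((⟨f ∘ x.1, h⟩ : {y : Fin n → Y // Function.Injective y}) :
              OnePoint {y : Fin n → Y // Function.Injective y})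
            else OnePoint.infty)) ⁻¹' S) : Set {x : Fin n → X // Function.Injective x})ᶜ =
        {x | f ∘ x.1 ∈ Subtype.val '' ((↑) ⁻¹' S : Set {y : Fin n → Y // Function.Injective y})ᶜ} := by
      ext x
      change ¬ ((if h : Function.Injective (f ∘ x.1) then _ else _) ∈ S) ↔ _
      by_cases h : Function.Injective (f ∘ x.1)
      · simp [h]
      · simp [h, hmem]
    rw [heq]
    exact ⟨hK.isClosed, hK⟩
  · rw [OnePoint.isOpen_iff_of_notMem hmem] at hS
    rw [OnePoint.isOpen_iff_of_notMem (by exact hmem)]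
    have hcont : Continuous fun x : {x : Fin n → X // Function.Injective x} => f ∘ x.1 :=
      continuous_pi fun i => hf.continuous.comp ((continuous_apply i).comp continuous_subtype_val)
    convert ((isOpen_setOf_injective.isOpenMap_subtype_val _ hS).preimage hcont) using 1
    ext x
    change ((if h : Function.Injective (f ∘ x.1) then _ else _) ∈ S) ↔ _
    by_cases h : Function.Injective (f ∘ x.1)
    · simp [h]
    · simp [h, hmem]
end

section
/- Let ζ = exp(2πi/3) ∈ ℂ. For all natural numbers a ≥ b, the complex number (1/12)·( s_{(a,b)}(1,1) + s_{(a,b)}(-1,-1) - 3·s_{(a,b)}(1,-1) - 3·s_{(a,b)}(-1,1) + 2·s_{(a,b)}(ζ,ζ⁻¹) + 2·s_{(a,b)}(-ζ,-ζ⁻¹) ) equals the natural number r_{(a,b)}, where r_{(a,b)} = ⌊(a-b)/6⌋ + 1 if a and b are both odd, r_{(a,b)} = ⌊(a-b)/6⌋ if a and b are both even, and r_{(a,b)} = 0 if a and b have opposite parities. -/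
open Finset

/-- The two-row Schur polynomial `s_{(a,b)}(x,y) = ∑_{i=b}^{a} x^i y^{a+b-i}`. -/
noncomputable def schurTwoRow (a b : ℕ) (x y : ℂ) : ℂ :=
  ∑ i ∈ Finset.Icc b a, x ^ i * y ^ (a + b - i)

/-- `ζ = exp(2πi/3)`, a primitive third root of unity. -/
noncomputable def zeta3 : ℂ := Complex.exp (2 * Real.pi * Complex.I / 3)

theorem schurTwoRow_add_left (n b : ℕ) (x y : ℂ) :
    schurTwoRow (b + n) b x y =
      (x * y) ^ b * ∑ i ∈ Finset.range (n + 1), x ^ i * y ^ (n - i) := by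
  rw [schurTwoRow, ← Finset.Ico_succ_right_eq_Icc, Finset.sum_Ico_eq_sum_range, Finset.mul_sum,
    Nat.succ_eq_succ, Nat.succ_eq_add_one, show b + n + 1 - b = n + 1 by lia]
  refine Finset.sum_congr rfl fun i hi => ?_
  have hi' := Finset.mem_range.mp hi
  rw [show b + n + b - (b + i) = b + (n - i) by lia]
  ring

theorem schurTwoRow_self (b : ℕ) (x y : ℂ) : schurTwoRow b b x y = (x * y) ^ b := by
  simpa using schurTwoRow_add_left 0 b x y

theorem schurTwoRow_add_one (b : ℕ) (x y : ℂ) :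
    schurTwoRow (b + 1) b x y = (x * y) ^ b * (x + y) := by
  rw [schurTwoRow_add_left]
  simp [Finset.sum_range_succ, add_comm]

theorem schurTwoRow_add_succ (n b : ℕ) (x y : ℂ) :
    schurTwoRow (b + (n + 1)) b x y =
      y * schurTwoRow (b + n) b x y + (x * y) ^ b * x ^ (n + 1) := by
  simp only [schurTwoRow_add_left]
  rw [Finset.sum_range_succ, Nat.sub_self, pow_zero, mul_one, mul_add, mul_left_comm y,
    Finset.mul_sum (Finset.range (n + 1)) _ y]
  congr 2
  refine Finset.sum_congr rfl fun i hi => ?_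
  have hi' := Finset.mem_range.mp hi
  rw [show n + 1 - i = n - i + 1 by lia]
  ring

theorem schurTwoRow_add_two (n b : ℕ) (x y : ℂ) :
    schurTwoRow (b + (n + 2)) b x y =
      (x + y) * schurTwoRow (b + (n + 1)) b x y - x * y * schurTwoRow (b + n) b x y := by
  rw [schurTwoRow_add_succ (n + 1), schurTwoRow_add_succ n]
  ring

theorem schurTwoRow_neg_neg (n b : ℕ) (x y : ℂ) :
    schurTwoRow (b + n) b (-x) (-y) = (-1) ^ n * schurTwoRow (b + n) b x y := by
  simp only [schurTwoRow_add_left, neg_mul_neg]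
  rw [mul_left_comm, Finset.mul_sum _ _ ((-1 : ℂ) ^ n)]
  congr 1
  refine Finset.sum_congr rfl fun i hi => ?_
  have hi' := Finset.mem_range.mp hi
  rw [neg_pow x, neg_pow y, mul_mul_mul_comm, ← pow_add, show i + (n - i) = n by lia]

theorem schurTwoRow_one_one (n b : ℕ) : schurTwoRow (b + n) b 1 1 = n + 1 := by
  simp [schurTwoRow_add_left]

theorem schurTwoRow_one_neg_one (n b : ℕ) :
    schurTwoRow (b + n) b 1 (-1) = if n % 2 = 0 then (-1) ^ b else 0 := by
  induction n using Nat.twoStepInduction with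
  | zero => simp [schurTwoRow_self]
  | one => simp [schurTwoRow_add_one]
  | more n ih _ => rw [schurTwoRow_add_two, ih]; split_ifs <;> simp_all

theorem zeta3_isPrimitiveRoot : IsPrimitiveRoot zeta3 3 := by
  simpa [zeta3] using Complex.isPrimitiveRoot_exp 3 (by norm_num)

theorem zeta3_add_inv : zeta3 + zeta3⁻¹ = -1 := by
  have h := zeta3_isPrimitiveRoot.geom_sum_eq_zero (by norm_num)
  have h₀ := zeta3_isPrimitiveRoot.ne_zero (by norm_num)
  simp only [Finset.sum_range_succ, Finset.sum_range_zero] at h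
  field_simp
  linear_combination h

theorem schurTwoRow_zeta3 (n b : ℕ) :
    schurTwoRow (b + n) b zeta3 zeta3⁻¹ =
      if n % 3 = 0 then 1 else if n % 3 = 1 then -1 else 0 := by
  have h : zeta3 * zeta3⁻¹ = 1 :=
    mul_inv_cancel₀ (zeta3_isPrimitiveRoot.ne_zero (by norm_num))
  induction n using Nat.twoStepInduction with
  | zero => simp [schurTwoRow_self, h]
  | one => simp [schurTwoRow_add_one, h, zeta3_add_inv]
  | more n ih₀ ih₁ =>
    rw [schurTwoRow_add_two, ih₀, ih₁, h, zeta3_add_inv]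
    obtain hn | hn | hn : n % 3 = 0 ∨ n % 3 = 1 ∨ n % 3 = 2 := by lia
    all_goals simp [Nat.add_mod, hn]

/-- For `a ≥ b`, the character inner product
`(1/12)(s_{(a,b)}(1,1) + s_{(a,b)}(-1,-1) - 3 s_{(a,b)}(1,-1) - 3 s_{(a,b)}(-1,1)
  + 2 s_{(a,b)}(ζ,ζ⁻¹) + 2 s_{(a,b)}(-ζ,-ζ⁻¹))`
equals `r_{(a,b)}`, where `r_{(a,b)} = ⌊(a-b)/6⌋ + 1` if `a, b` are both odd,
`r_{(a,b)} = ⌊(a-b)/6⌋` if `a, b` are both even, and `r_{(a,b)} = 0` otherwise. -/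
theorem schur_inner_product_r (a b : ℕ) (hab : b ≤ a) :
    (1 / 12 : ℂ) *
        (schurTwoRow a b 1 1 + schurTwoRow a b (-1) (-1) - 3 * schurTwoRow a b 1 (-1)
          - 3 * schurTwoRow a b (-1) 1 + 2 * schurTwoRow a b zeta3 zeta3⁻¹
          + 2 * schurTwoRow a b (-zeta3) (-zeta3⁻¹)) =
      ((if a % 2 = 1 ∧ b % 2 = 1 then (a - b) / 6 + 1
        else if a % 2 = 0 ∧ b % 2 = 0 then (a - b) / 6
        else 0 : ℕ) : ℂ) := by
  obtain ⟨n, rfl⟩ := Nat.exists_eq_add_of_le hab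
  have h_swap : schurTwoRow (b + n) b (-1) 1 = (-1) ^ n * schurTwoRow (b + n) b 1 (-1) := by
    simpa using schurTwoRow_neg_neg n b 1 (-1)
  rw [h_swap, schurTwoRow_neg_neg, schurTwoRow_neg_neg, schurTwoRow_one_one,
    schurTwoRow_one_neg_one, schurTwoRow_zeta3, Nat.add_sub_cancel_left]
  rcases Nat.even_or_odd n with hn | hn
  · have hn₂ : n % 2 = 0 := Nat.even_iff.mp hn
    have hbn : (b + n) % 2 = b % 2 := by lia
    have hdiv : (n : ℂ) = 6 * (n / 6 : ℕ) + (n % 6 : ℕ) := by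
      exact_mod_cast (Nat.div_add_mod n 6).symm
    rw [hn.neg_one_pow, if_pos hn₂, hbn, hdiv]
    obtain ⟨h₆, h₃⟩ | ⟨h₆, h₃⟩ | ⟨h₆, h₃⟩ :
        (n % 6 = 0 ∧ n % 3 = 0) ∨ (n % 6 = 2 ∧ n % 3 = 2) ∨ (n % 6 = 4 ∧ n % 3 = 1) := by lia
    all_goals
      rcases Nat.even_or_odd b with hb | hb
      · have hb₂ : b % 2 = 0 := Nat.even_iff.mp hb
        simp [hb.neg_one_pow, hb₂, h₆, h₃]
        ring
      · have hb₂ : b % 2 = 1 := Nat.odd_iff.mp hb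
        simp [hb.neg_one_pow, hb₂, h₆, h₃]
        ring
  · have hn₂ : n % 2 = 1 := Nat.odd_iff.mp hn
    have h₁ : ¬((b + n) % 2 = 1 ∧ b % 2 = 1) := by lia
    have h₀ : ¬((b + n) % 2 = 0 ∧ b % 2 = 0) := by lia
    rw [hn.neg_one_pow, if_neg (by lia : ¬n % 2 = 0), if_neg h₁, if_neg h₀]
    push_cast
    ring
end

section
/- Fix natural numbers n ≥ 1 and g ≥ 1. Let S be the set of pairs (k, v) with k ∈ Fin n and v : { j : Fin n // j ≠ k } → Fin g, and let ~ be the equivalence relation on S generated by the relation: (k, v) ~ (j, w) whenever j ≠ k, w(k) = v(j), and w(i) = v(i) for every index i distinct from both j and k. Then the map sending (k, v) to the multiset of the n-1 values of v induces a well-defined bijection from the quotient S/~ onto the set Sym (Fin g) (n-1) of multisets of size n-1 with elements in Fin g; consequently the number of equivalence classes is the binomial coefficient (n+g-2 choose n-1). -/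
/-- The index set `S` of pairs `(k, v)` with `k ∈ Fin n` and `v : {j // j ≠ k} → Fin g`,
indexing the basis of the 0-th column of the Chevalley–Eilenberg complex: a tuple with an
empty slot at position `k` and a cohomology label `v j` at every other position `j`. -/
def ConfigIndex (n g : ℕ) : Type :=
  Σ k : Fin n, ({j : Fin n // j ≠ k} → Fin g)

/-- The generating relation: `(k, v) ~ (j, w)` whenever `j ≠ k`, `w k = v j`, and
`w i = v i` for every index `i` distinct from both `j` and `k`. -/
def collisionRel (n g : ℕ) : ConfigIndex n g → ConfigIndex n g → Prop := fun p q =>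
  ∃ h : q.1 ≠ p.1,
    q.2 ⟨p.1, Ne.symm h⟩ = p.2 ⟨q.1, h⟩ ∧
      ∀ (i : Fin n) (hik : i ≠ p.1) (hij : i ≠ q.1), q.2 ⟨i, hij⟩ = p.2 ⟨i, hik⟩

/-- Two functions on a finite type with the same multiset of values differ by a permutation. -/
theorem Multiset.map_univ_eq_map_univ_iff {α β : Type*} [Fintype α] (f f' : α → β) :
    Multiset.map f Finset.univ.val = Multiset.map f' Finset.univ.val ↔
      ∃ σ : Equiv.Perm α, f = f' ∘ σ := by
  classical
  constructor
  · intro h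
    have e : ∀ b, Nonempty ({a // f a = b} ≃ {a // f' a = b}) := fun b => by
      have hb := congrArg (Multiset.count b) h
      rw [Multiset.count_map, Multiset.count_map] at hb
      refine ⟨Fintype.equivOfCardEq ?_⟩
      rw [Fintype.card_subtype, Fintype.card_subtype]
      simp only [@eq_comm _ b] at hb
      exact hb
    exact ⟨Equiv.ofFiberEquiv fun b => (e b).some,
      funext fun a => (Equiv.ofFiberEquiv_map _ a).symm⟩
  · rintro ⟨σ, rfl⟩
    rw [← Multiset.map_map, Multiset.map_univ_val_equiv]

namespace ConfigIndex

variable {n g : ℕ}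

/-- The multiset of labels of a configuration. -/
def labels (p : ConfigIndex n g) : Multiset (Fin g) :=
  Multiset.map p.2 (Finset.univ : Finset {j : Fin n // j ≠ p.1}).val

/-- The configuration as a function on all positions, with value `none` at the empty slot. -/
def toOption (p : ConfigIndex n g) (i : Fin n) : Option (Fin g) :=
  if h : i = p.1 then none else some (p.2 ⟨i, h⟩)

@[simp]
theorem toOption_eq_none_iff (p : ConfigIndex n g) (i : Fin n) :
    p.toOption i = none ↔ i = p.1 := by
  simp [toOption]

theorem toOption_of_ne (p : ConfigIndex n g) {i : Fin n} (h : i ≠ p.1) :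
    p.toOption i = some (p.2 ⟨i, h⟩) := by
  simp [toOption, h]

theorem toOption_injective : Function.Injective (toOption : ConfigIndex n g → _) := by
  rintro ⟨k, v⟩ ⟨l, w⟩ h
  obtain rfl : k = l := by
    have hk := (toOption_eq_none_iff ⟨k, v⟩ k).2 rfl
    rw [h] at hk
    exact (toOption_eq_none_iff _ _).1 hk
  have : v = w := by
    funext i
    have hi := congrFun h i.1
    rw [toOption_of_ne ⟨k, v⟩ i.2, toOption_of_ne ⟨k, w⟩ i.2] at hi
    exact Option.some_injective _ hi
  rw [this]

theorem collisionRel_iff_toOption (p q : ConfigIndex n g) :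
    collisionRel n g p q ↔
      q.1 ≠ p.1 ∧ q.toOption = p.toOption ∘ Equiv.swap p.1 q.1 := by
  constructor
  · rintro ⟨h, h₁, h₂⟩
    refine ⟨h, funext fun i => ?_⟩
    by_cases hp : i = p.1
    · subst hp
      simp [toOption_of_ne _ h, toOption_of_ne _ h.symm, h₁]
    by_cases hq : i = q.1
    · subst hq
      simp [(toOption_eq_none_iff _ _).2]
    simp [Equiv.swap_apply_of_ne_of_ne hp hq, toOption_of_ne _ hp, toOption_of_ne _ hq, h₂ i hp hq]
  · rintro ⟨h, hf⟩
    refine ⟨h, ?_, fun i hp hq => ?_⟩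
    · have := congrFun hf p.1
      simpa [toOption_of_ne _ h, toOption_of_ne _ h.symm] using this
    · have := congrFun hf i
      simpa [Equiv.swap_apply_of_ne_of_ne hp hq, toOption_of_ne _ hp, toOption_of_ne _ hq]
        using this

theorem map_toOption_univ (p : ConfigIndex n g) :
    Multiset.map p.toOption Finset.univ.val = none ::ₘ p.labels.map some := by
  have hu : (Finset.univ : Finset (Fin n)).val =
      p.1 ::ₘ (Finset.univ : Finset {j : Fin n // j ≠ p.1}).val.map Subtype.val := by
    rw [Finset.univ_val_map_subtype_val, Finset.filter_ne', Finset.erase_val,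
      Multiset.cons_erase (Finset.mem_univ p.1)]
  rw [hu, Multiset.map_cons, (toOption_eq_none_iff p p.1).2 rfl, labels, Multiset.map_map,
    Multiset.map_map]
  congr 1
  exact Multiset.map_congr rfl fun i _ => toOption_of_ne p i.2

/-- Permuting the positions of a configuration. -/
def permute (σ : Equiv.Perm (Fin n)) (p : ConfigIndex n g) : ConfigIndex n g :=
  ⟨σ p.1, fun j => p.2 ⟨σ.symm j, fun h => j.2 (σ.symm_apply_eq.1 h)⟩⟩

theorem toOption_permute (σ : Equiv.Perm (Fin n)) (p : ConfigIndex n g) :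
    (permute σ p).toOption = p.toOption ∘ σ.symm := by
  funext i
  by_cases h : σ.symm i = p.1
  · rw [Function.comp_apply, (toOption_eq_none_iff _ _).2 h, toOption_eq_none_iff]
    exact σ.symm_apply_eq.1 h
  · rw [Function.comp_apply, toOption_of_ne p h]
    exact toOption_of_ne (permute σ p) fun h' => h (σ.symm_apply_eq.2 h')

theorem permute_mul (σ τ : Equiv.Perm (Fin n)) (p : ConfigIndex n g) :
    permute (σ * τ) p = permute σ (permute τ p) := rfl

theorem mk_permute_swap_slot (p : ConfigIndex n g) {i : Fin n} (hi : i = p.1) (j : Fin n) :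
    Quot.mk (collisionRel n g) (permute (Equiv.swap i j) p) = Quot.mk _ p := by
  subst hi
  by_cases h : j = p.1
  · subst h
    rw [Equiv.swap_self]
    rfl
  · refine (Quot.sound ((collisionRel_iff_toOption _ _).2 ?_)).symm
    have hj : (permute (Equiv.swap p.1 j) p).1 = j := Equiv.swap_apply_left _ _
    rw [hj, toOption_permute, Equiv.symm_swap]
    exact ⟨h, rfl⟩

theorem mk_permute_swap (p : ConfigIndex n g) {x y : Fin n} (hxy : x ≠ y) :
    Quot.mk (collisionRel n g) (permute (Equiv.swap x y) p) = Quot.mk _ p := by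
  by_cases hx : x = p.1
  · exact mk_permute_swap_slot p hx y
  by_cases hy : y = p.1
  · rw [Equiv.swap_comm]
    exact mk_permute_swap_slot p hy x
  have h : Equiv.swap x y = Equiv.swap y p.1 * (Equiv.swap x y * Equiv.swap p.1 x) := by
    ext i
    simp only [Equiv.Perm.mul_apply, Equiv.swap_apply_def]
    split_ifs <;> simp_all
  rw [h, permute_mul, permute_mul, mk_permute_swap_slot, mk_permute_swap_slot,
    mk_permute_swap_slot _ rfl]
  · simp [permute]
  · simp [permute]

theorem mk_permute (σ : Equiv.Perm (Fin n)) (p : ConfigIndex n g) :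
    Quot.mk (collisionRel n g) (permute σ p) = Quot.mk _ p := by
  induction σ using Equiv.Perm.swap_induction_on with
  | one => rfl
  | swap_mul τ x y hxy ih => rw [permute_mul, mk_permute_swap _ hxy, ih]

theorem labels_eq_iff (p q : ConfigIndex n g) :
    p.labels = q.labels ↔ Quot.mk (collisionRel n g) p = Quot.mk _ q := by
  have labels_iff : ∀ p q : ConfigIndex n g, p.labels = q.labels ↔
      Multiset.map p.toOption Finset.univ.val = Multiset.map q.toOption Finset.univ.val :=
    fun p q => by
      rw [map_toOption_univ, map_toOption_univ, Multiset.cons_inj_right,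
        (Multiset.map_injective (Option.some_injective _)).eq_iff]
  constructor
  · intro h
    obtain ⟨σ, hσ⟩ := (Multiset.map_univ_eq_map_univ_iff _ _).1 ((labels_iff p q).1 h)
    have hp : p = permute σ.symm q := toOption_injective (by rw [toOption_permute]; exact hσ)
    rw [hp, mk_permute]
  · intro h
    refine congrArg (Quot.lift labels fun a b hab => ?_) h
    exact Eq.symm <| (labels_iff b a).2 ((Multiset.map_univ_eq_map_univ_iff _ _).2
      ⟨Equiv.swap a.1 b.1, ((collisionRel_iff_toOption a b).1 hab).2⟩)

theorem card_labels (p : ConfigIndex n g) : p.labels.card = n - 1 := by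
  simp [labels]

theorem exists_labels_eq (hn : 1 ≤ n) (s : Sym (Fin g) (n - 1)) :
    ∃ p : ConfigIndex n g, p.labels = s := by
  obtain ⟨m, rfl⟩ := Nat.exists_eq_add_of_le' hn
  obtain ⟨f, hf⟩ : ∃ f : Fin m → Fin g, Multiset.map f Finset.univ.val = s := by
    obtain ⟨⟨l⟩, hl⟩ := s
    obtain rfl : l.length = m := hl
    exact ⟨l.get, by rw [Fin.univ_val_map, List.ofFn_get]; rfl⟩
  refine ⟨⟨0, f ∘ (finSuccAboveEquiv 0).symm⟩, ?_⟩
  rw [← hf]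
  change Multiset.map (f ∘ (finSuccAboveEquiv 0).symm) _ = _
  rw [← Multiset.map_map, Multiset.map_univ_val_equiv]

/-- The map from collision classes to multisets induced by `labels`. -/
def classLabels (n g : ℕ) : Quot (collisionRel n g) → Sym (Fin g) (n - 1) :=
  Quot.lift (fun p => ⟨p.labels, p.card_labels⟩) fun p q h =>
    Subtype.ext ((labels_eq_iff p q).2 (Quot.sound h))

theorem classLabels_bijective (hn : 1 ≤ n) : Function.Bijective (classLabels n g) := by
  constructor
  · rintro ⟨p⟩ ⟨q⟩ h
    exact (labels_eq_iff p q).1 (congrArg Subtype.val h)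
  · intro s
    obtain ⟨p, hp⟩ := exists_labels_eq hn s
    exact ⟨Quot.mk _ p, Subtype.ext hp⟩

end ConfigIndex

/-- The map sending `(k, v)` to the multiset of the `n-1` values of `v` induces a
well-defined bijection from the quotient of `ConfigIndex n g` by the equivalence relation
generated by `collisionRel n g` onto the set `Sym (Fin g) (n-1)` of multisets of size `n-1`
with elements in `Fin g`; consequently the number of equivalence classes is the binomial
coefficient `(n+g-2).choose (n-1)`. -/
theorem collision_classes_bijection (n g : ℕ) (hn : 1 ≤ n) (hg : 1 ≤ g) :
    (∃ e : Quot (collisionRel n g) ≃ Sym (Fin g) (n - 1),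
      ∀ p : ConfigIndex n g,
        ((e (Quot.mk (collisionRel n g) p) : Sym (Fin g) (n - 1)) : Multiset (Fin g)) =
          Multiset.map p.2 (Finset.univ : Finset {j : Fin n // j ≠ p.1}).val) ∧
    Nat.card (Quot (collisionRel n g)) = (n + g - 2).choose (n - 1) := by
  have e := Equiv.ofBijective _ (ConfigIndex.classLabels_bijective (g := g) hn)
  refine ⟨⟨Equiv.ofBijective _ (ConfigIndex.classLabels_bijective hn), fun p => rfl⟩, ?_⟩
  rw [Nat.card_congr e, Nat.card_eq_fintype_card, Sym.card_sym_eq_choose, Fintype.card_fin]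
  congr 1
  omega
end
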